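/- arXiv:0903.2866 — 2 statements merged into one kernel-verified Lean document; each statement's English description precedes it below -/
import Mathlib

section
/- For every prime p, one has U_p = ⋃_{k≥1} U_{p,k}; that is, a positive integer d divides p^n + 1 for some integer n ≥ 1 if and only if d is coprime to p and there exists a positive integer k such that every odd prime factor r of d satisfies v_2(ℓ_p(r)) = k, and moreover if p > 2 and k = 1 then v_2(d) ≤ v_2(p+1), while if p > 2 and k > 1 then v_2(d) ≤ 1. -/
open UniqueFactorizationMonoid in
/-- Lifting `-1` from the radical of an odd modulus to the modulus itself. -/
theorem exists_odd_dvd_pow_add_one {m x : ℕ} (hm : Odd m)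
    (h : ∀ r : ℕ, r.Prime → r ∣ m → r ∣ x + 1) : ∃ c : ℕ, Odd c ∧ m ∣ x ^ c + 1 := by
  have hm0 : m ≠ 0 := hm.pos.ne'
  have hR : Odd (radical m) := hm.of_dvd_nat radical_dvd_self
  have hRx : radical m ∣ x + 1 :=
    (Nat.radical_dvd_iff (Nat.succ_ne_zero x)).2 fun r hr =>
      Nat.mem_primeFactors.2 ⟨Nat.prime_of_mem_primeFactors hr,
        h r (Nat.prime_of_mem_primeFactors hr) (Nat.dvd_of_mem_primeFactors hr),
        Nat.succ_ne_zero x⟩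
  have hc : Odd (radical m ^ m) := hR.pow
  refine ⟨radical m ^ m, hc, ?_⟩
  have h1 : ((radical m : ℕ) : ℤ) ∣ (x : ℤ) - (-1) := by
    rw [sub_neg_eq_add]
    exact_mod_cast hRx
  have h2 := dvd_sub_pow_of_dvd_sub h1 m
  rw [hc.neg_one_pow, sub_neg_eq_add] at h2
  have h3 : radical m ^ (m + 1) ∣ x ^ radical m ^ m + 1 := by exact_mod_cast h2
  exact ((Nat.dvd_radical_pow_self hm0).trans (pow_dvd_pow _ m.le_succ)).trans h3

theorem padicValNat_two_eq_succ_of_dvd_two_mul {o n : ℕ} (hn : n ≠ 0) (h : o ∣ 2 * n)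
    (h' : ¬ o ∣ n) : padicValNat 2 o = padicValNat 2 n + 1 := by
  obtain ⟨c, hc⟩ := h
  have ho : o ≠ 0 := by rintro rfl; omega
  have hc0 : c ≠ 0 := by rintro rfl; omega
  have hodd : ¬ 2 ∣ c := by
    rintro ⟨e, rfl⟩
    exact h' ⟨e, by linarith [mul_left_comm o 2 e]⟩
  have hv := congrArg (padicValNat 2) hc
  rw [padicValNat.mul two_ne_zero hn, padicValNat.mul ho hc0,
    padicValNat.eq_zero_of_not_dvd hodd, padicValNat.self one_lt_two] at hv
  omega

theorem padicValNat_two_orderOf_of_dvd_pow_add_one {p n r : ℕ} (hr : r.Prime) (hr2 : Odd r)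
    (hn : n ≠ 0) (h : r ∣ p ^ n + 1) :
    padicValNat 2 (orderOf (p : ZMod r)) = padicValNat 2 n + 1 := by
  have : Fact r.Prime := ⟨hr⟩
  have : Fact (2 < r) := ⟨by have := hr.two_le; obtain ⟨t, rfl⟩ := hr2; omega⟩
  have hx : (p : ZMod r) ^ n = -1 := by
    have := (ZMod.natCast_eq_zero_iff _ _).2 h
    push_cast at this
    exact eq_neg_of_add_eq_zero_left this
  refine padicValNat_two_eq_succ_of_dvd_two_mul hn ?_ ?_
  · rw [orderOf_dvd_iff_pow_eq_one, mul_comm, pow_mul, hx, neg_one_sq]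
  · rw [orderOf_dvd_iff_pow_eq_one, hx]
    exact ZMod.neg_one_ne_one

theorem dvd_pow_add_one_of_padicValNat_two_orderOf {p r k M s : ℕ} (hr : r.Prime)
    (hpr : Nat.Coprime p r) (hk : 1 ≤ k) (hM : Odd M) (hrM : r - 1 ∣ 2 ^ s * M)
    (h : padicValNat 2 (orderOf (p : ZMod r)) = k) : r ∣ p ^ (2 ^ (k - 1) * M) + 1 := by
  have : Fact r.Prime := ⟨hr⟩
  have hp0 : (p : ZMod r) ≠ 0 := by
    rw [Ne, ZMod.natCast_eq_zero_iff]
    exact (Nat.Prime.coprime_iff_not_dvd hr).1 hpr.symm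
  have hor : orderOf (p : ZMod r) ∣ r - 1 :=
    orderOf_dvd_of_pow_eq_one (ZMod.pow_card_sub_one_eq_one hp0)
  have ho0 : orderOf (p : ZMod r) ≠ 0 := by
    intro h0
    rw [h0, padicValNat_zero_right] at h
    omega
  obtain ⟨j, c, hc, hjc⟩ := Nat.exists_eq_two_pow_mul_odd ho0
  have hj : j = k := by
    rw [hjc, padicValNat.mul (by positivity) hc.pos.ne', padicValNat.prime_pow,
      padicValNat.eq_zero_of_not_dvd hc.not_two_dvd_nat] at h
    omega
  subst hj
  have hcM : c ∣ M := by
    have h1 : c ∣ 2 ^ s * M := ((hjc ▸ dvd_mul_left c _).trans hor).trans hrM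
    exact (Nat.Coprime.pow_right s (Nat.coprime_two_right.2 hc)).dvd_of_dvd_mul_left h1
  have hsq : ((p : ZMod r) ^ (2 ^ (j - 1) * M)) ^ 2 = 1 := by
    rw [← pow_mul, ← orderOf_dvd_iff_pow_eq_one, hjc,
      show 2 ^ (j - 1) * M * 2 = 2 ^ (j - 1 + 1) * M by ring, Nat.sub_add_cancel hk]
    exact mul_dvd_mul_left _ hcM
  have hne : (p : ZMod r) ^ (2 ^ (j - 1) * M) ≠ 1 := by
    rw [Ne, ← orderOf_dvd_iff_pow_eq_one, hjc]
    intro hd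
    have h1 : 2 ^ (j - 1) * 2 ∣ 2 ^ (j - 1) * M := by
      rw [← pow_succ, Nat.sub_add_cancel hk]
      exact (dvd_mul_right _ _).trans hd
    exact hM.not_two_dvd_nat (Nat.dvd_of_mul_dvd_mul_left (by positivity) h1)
  rw [← ZMod.natCast_eq_zero_iff]
  push_cast
  rw [(sq_eq_one_iff.1 hsq).resolve_left hne, neg_add_cancel]

theorem two_pow_dvd_add_one_of_dvd_pow_add_one {a p n : ℕ} (hn : Odd n)
    (h : 2 ^ a ∣ p ^ n + 1) : 2 ^ a ∣ p + 1 := by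
  rcases Nat.eq_zero_or_pos a with rfl | ha
  · simp
  have hx : (-(p : ZMod (2 ^ a))) ^ n = 1 := by
    have := (ZMod.natCast_eq_zero_iff _ _).2 h
    push_cast at this
    rw [hn.neg_pow, eq_neg_of_add_eq_zero_left this, neg_neg]
  let u : (ZMod (2 ^ a))ˣ := Units.ofPowEqOne _ n hx hn.pos.ne'
  have hu : (u : ZMod (2 ^ a)) = -(p : ZMod (2 ^ a)) := rfl
  have h1 : orderOf u ∣ n := orderOf_dvd_of_pow_eq_one (Units.ext (by simpa [hu] using hx))
  have h2 : orderOf u ∣ 2 ^ (a - 1) := by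
    have := orderOf_dvd_of_pow_eq_one (ZMod.pow_totient u)
    rwa [Nat.totient_prime_pow Nat.prime_two ha, Nat.add_one_sub_one, mul_one] at this
  have h3 : orderOf u = 1 :=
    Nat.eq_one_of_dvd_coprimes (Nat.Coprime.pow_right _ (Nat.coprime_two_right.2 hn)) h1 h2
  have h4 : -(p : ZMod (2 ^ a)) = 1 := by rw [← hu, orderOf_eq_one_iff.1 h3, Units.val_one]
  rw [← ZMod.natCast_eq_zero_iff]
  push_cast
  rw [← h4, add_neg_cancel]

theorem not_four_dvd_pow_add_one_of_even {p n : ℕ} (hn : Even n) : ¬ 4 ∣ p ^ n + 1 := by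
  obtain ⟨t, rfl⟩ := hn
  have h : p ^ (t + t) = p ^ t * p ^ t := pow_add _ _ _
  rw [h, Nat.dvd_iff_mod_eq_zero, Nat.add_mod, Nat.mul_mod]
  have : p ^ t % 4 < 4 := Nat.mod_lt _ (by norm_num)
  interval_cases p ^ t % 4 <;> norm_num


/-- For every prime `p`, a positive integer `d` divides
`p ^ n + 1` for some `n ≥ 1` if and only if `d` is coprime to `p` and there
is `k ≥ 1` such that every odd prime factor `r` of `d` satisfies
`v₂(ℓ_p(r)) = k`, and moreover `v₂(d) ≤ v₂(p+1)` if `p > 2` and `k = 1`,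
while `v₂(d) ≤ 1` if `p > 2` and `k > 1`.  (That is, `U_p = ⋃_{k ≥ 1} U_{p,k}`.) -/
theorem rank_stats_stmt2 (p : ℕ) (hp : p.Prime) (d : ℕ) (hd : 0 < d) :
    (∃ n : ℕ, 1 ≤ n ∧ d ∣ p ^ n + 1) ↔
      (Nat.Coprime d p ∧ ∃ k : ℕ, 1 ≤ k ∧
        (∀ r : ℕ, r.Prime → Odd r → r ∣ d →
          padicValNat 2 (orderOf ((p : ZMod r))) = k) ∧
        (2 < p → k = 1 → padicValNat 2 d ≤ padicValNat 2 (p + 1)) ∧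
        (2 < p → 1 < k → padicValNat 2 d ≤ 1)) := by
  have hF2 : Fact (Nat.Prime 2) := ⟨Nat.prime_two⟩
  constructor
  · rintro ⟨n, hn, hdn⟩
    have hn0 : n ≠ 0 := by omega
    refine ⟨?_, padicValNat 2 n + 1, by omega, ?_, ?_, ?_⟩
    · have h1 : Nat.Coprime (p ^ n + 1) (p ^ n) := by simp
      exact (h1.coprime_dvd_left hdn).coprime_dvd_right (dvd_pow_self p hn0)
    · intro r hr hr2 hrd
      exact padicValNat_two_orderOf_of_dvd_pow_add_one hr hr2 hn0 (hrd.trans hdn)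
    · intro _ hk
      have hodd : Odd n := by
        rw [← Nat.not_even_iff_odd, even_iff_two_dvd,
          dvd_iff_padicValNat_ne_zero hn0]
        omega
      exact (padicValNat_dvd_iff_le p.succ_ne_zero).1
        (two_pow_dvd_add_one_of_dvd_pow_add_one hodd (pow_padicValNat_dvd.trans hdn))
    · intro _ hk
      have heven : Even n := by
        rw [even_iff_two_dvd, dvd_iff_padicValNat_ne_zero hn0]
        omega
      by_contra hlt
      have h2 : 2 ^ 2 ∣ d := (padicValNat_dvd_iff_le hd.ne').2 (by omega)
      exact not_four_dvd_pow_add_one_of_even heven (h2.trans hdn)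
  · rintro ⟨hco, k, hk, hord, h1, h2⟩
    obtain ⟨a, m, hm, rfl⟩ := Nat.exists_eq_two_pow_mul_odd hd.ne'
    have ha : padicValNat 2 (2 ^ a * m) = a := by
      rw [padicValNat.mul (by positivity) hm.pos.ne', padicValNat.prime_pow,
        padicValNat.eq_zero_of_not_dvd hm.not_two_dvd_nat, add_zero]
    rw [ha] at h1 h2
    obtain ⟨s, M, hM, hsM⟩ := Nat.exists_eq_two_pow_mul_odd (Nat.totient_pos.2 hm.pos).ne'
    obtain ⟨c, hc, hmc⟩ := exists_odd_dvd_pow_add_one (x := p ^ (2 ^ (k - 1) * M)) hm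
      fun r hr hrm => by
        have hrd : r ∣ 2 ^ a * m := hrm.mul_left _
        refine dvd_pow_add_one_of_padicValNat_two_orderOf (s := s) hr
          (hco.coprime_dvd_left hrd).symm hk hM ?_ (hord r hr (hm.of_dvd_nat hrm) hrd)
        rw [← hsM, ← Nat.totient_prime hr]
        exact Nat.totient_dvd_of_dvd hrm
    have hcM : Odd (M * c) := hM.mul hc
    refine ⟨2 ^ (k - 1) * M * c, ?_, ?_⟩
    · exact Nat.mul_pos (Nat.mul_pos (by positivity) hM.pos) hc.pos
    rw [← pow_mul] at hmc
    refine (Nat.Coprime.pow_left a (Nat.coprime_two_left.2 hm)).mul_dvd_of_dvd_of_dvd ?_ hmc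
    rcases hp.eq_two_or_odd' with rfl | hpodd
    · have ha0 : a = 0 := by
        by_contra ha0
        exact Nat.not_coprime_of_dvd_of_dvd one_lt_two ((dvd_pow_self 2 ha0).mul_right m)
          dvd_rfl hco
      simp [ha0]
    have hp2 : 2 < p := by
      have := hp.two_le
      obtain ⟨t, rfl⟩ := hpodd
      omega
    rcases hk.eq_or_lt with rfl | hk1
    · have h3 := (padicValNat_dvd_iff_le p.succ_ne_zero).2 (h1 hp2 rfl)
      have h4 : p + 1 ∣ p ^ (M * c) + 1 := by simpa using hcM.nat_add_dvd_pow_add_pow p 1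
      simpa using h3.trans h4
    · exact (pow_dvd_pow 2 (h2 hp2 hk1)).trans
        (by rw [pow_one]; exact even_iff_two_dvd.1 hpodd.pow.add_one)
end

section
/- Let p be a prime and let q be a power of p. There exists x_0(q) such that for all x ≥ x_0(q), Σ_{d ≤ x, d ∈ U_p} Σ_{e | d} φ(e)/ℓ_q(e) ≤ x^{2 − (2 + log_3 x)/(2·log_2 x)}. (Every divisor e of a member of U_p is coprime to p and hence to q, so ℓ_q(e) is defined.) -/
open scoped Classical

/-- The iterated logarithm: `logI 0 x = x`, `logI (ν+1) x = max (log (logI ν x)) 1`,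
so that `logI 1 x = log_1 x = max (log x, 1)` and `logI ν x = log_ν x`. -/
noncomputable def logI : ℕ → ℝ → ℝ
  | 0, x => x
  | ν + 1, x => max (Real.log (logI ν x)) 1

lemma sum_rpow_neg_le_exp {c : ℝ} (hc : 1 / 2 ≤ c) {s T : Finset ℕ} (hs : ∀ p ∈ s, p.Prime)
    (hT : ∀ n ∈ T, n ≠ 0 ∧ n.primeFactors ⊆ s) :
    ∑ n ∈ T, (n : ℝ) ^ (-c) ≤ Real.exp (4 * ∑ p ∈ s, (p : ℝ) ^ (-c)) := by
  let f : ℕ →* ℝ :=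
    { toFun := fun n => (n : ℝ) ^ (-c)
      map_one' := by simp
      map_mul' := fun a b => by
        push_cast
        exact Real.mul_rpow (Nat.cast_nonneg a) (Nat.cast_nonneg b) }
  have hf : ∀ n, f n = (n : ℝ) ^ (-c) := fun n => rfl
  have hf0 : ∀ n, 0 ≤ f n := fun n => Real.rpow_nonneg (Nat.cast_nonneg n) _
  have hfp : ∀ p : ℕ, p.Prime → f p ≤ 3 / 4 := by
    intro p hp
    have h2 : (2 : ℝ) ≤ p := by exact_mod_cast hp.two_le
    have h1 : (p : ℝ) ^ (-c) ≤ (2 : ℝ) ^ (-c) :=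
      Real.rpow_le_rpow_of_nonpos (by norm_num) h2 (by linarith)
    have h3 : (2 : ℝ) ^ (-c) ≤ (2 : ℝ) ^ (-(1 / 2) : ℝ) :=
      Real.rpow_le_rpow_of_exponent_le (by norm_num) (by linarith)
    have h4 : (2 : ℝ) ^ (-(1 / 2) : ℝ) ≤ 3 / 4 := by
      rw [Real.rpow_neg (by norm_num), ← Real.sqrt_eq_rpow]
      have : (4 / 3 : ℝ) ≤ √2 := Real.le_sqrt_of_sq_le (by norm_num)
      calc (√2)⁻¹ ≤ (4 / 3 : ℝ)⁻¹ := inv_anti₀ (by norm_num) this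
        _ = 3 / 4 := by norm_num
    rw [hf]; linarith
  obtain ⟨hsum, hprod⟩ :=
    EulerProduct.summable_and_hasSum_factoredNumbers_prod_filter_prime_geometric (f := f)
      (fun {p} hp => by
        rw [Real.norm_of_nonneg (hf0 p)]
        linarith [hfp p hp]) s
  have hsub : ∀ n ∈ T, n ∈ Nat.factoredNumbers s := fun n hn =>
    Nat.mem_factoredNumbers_of_primeFactors_subset (hT n hn).1 (hT n hn).2
  have h1 : ∑ n ∈ T, f n ≤ ∏ p ∈ s with p.Prime, (1 - f p)⁻¹ := by
    rw [← Finset.sum_subtype_of_mem f hsub]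
    exact sum_le_hasSum _ (fun i _ => hf0 i) hprod
  refine h1.trans ?_
  rw [Finset.filter_true_of_mem hs, Finset.mul_sum, Real.exp_sum]
  refine Finset.prod_le_prod (fun p hp => ?_) fun p hp => ?_
  · have := hfp p (hs p hp)
    exact inv_nonneg.2 (by linarith)
  · have h34 := hfp p (hs p hp)
    have h0 := hf0 p
    have h5 : (1 - f p)⁻¹ ≤ 4 * f p + 1 := by
      rw [inv_le_iff_one_le_mul₀ (by linarith)]
      nlinarith
    exact h5.trans (Real.add_one_le_exp _)

lemma sum_Icc_rpow_sub_one_le {a : ℝ} (ha : 0 < a) (ha1 : a ≤ 1) (K : ℕ) :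
    ∑ k ∈ Finset.Icc 1 K, (k : ℝ) ^ (a - 1) ≤ (K : ℝ) ^ a / a := by
  induction K with
  | zero => simp [Real.zero_rpow ha.ne']
  | succ K ih =>
    rw [Finset.sum_Icc_succ_top (by omega)]
    have hK : (0 : ℝ) < (K + 1 : ℕ) := by positivity
    have hb := rpow_one_add_le_one_add_mul_self (s := -1 / ((K + 1 : ℕ) : ℝ))
      (by rw [le_div_iff₀ hK]; push_cast; linarith [(Nat.cast_nonneg K : (0 : ℝ) ≤ K)]) ha.le ha1
    have h1 : (1 + -1 / ((K + 1 : ℕ) : ℝ)) = (K : ℝ) / (K + 1 : ℕ) := by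
      field_simp; push_cast; ring
    rw [h1, Real.div_rpow (Nat.cast_nonneg _) hK.le,
      div_le_iff₀ (Real.rpow_pos_of_pos hK a)] at hb
    have h2 : ((K + 1 : ℕ) : ℝ) ^ (a - 1) = ((K + 1 : ℕ) : ℝ) ^ a / (K + 1 : ℕ) := by
      rw [Real.rpow_sub hK, Real.rpow_one]
    rw [le_div_iff₀ ha] at ih ⊢
    rw [h2]
    have h3 : (1 + a * (-1 / ((K + 1 : ℕ) : ℝ))) * ((K + 1 : ℕ) : ℝ) ^ a
      = ((K + 1 : ℕ) : ℝ) ^ a - a * (((K + 1 : ℕ) : ℝ) ^ a / (K + 1 : ℕ)) := by ring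
    rw [h3] at hb
    linarith

lemma sum_rpow_sub_one_le_of_card_le {a : ℝ} (ha : 0 < a) (ha1 : a ≤ 1) {T : Finset ℕ} {K : ℕ}
    (hT : ∀ k ∈ T, 1 ≤ k) (hK : 1 ≤ K) (hcard : T.card ≤ K) :
    ∑ k ∈ T, (k : ℝ) ^ (a - 1) ≤ 2 / a * (K : ℝ) ^ a := by
  have hK0 : (0 : ℝ) < K := by exact_mod_cast hK
  rw [← Finset.sum_filter_add_sum_filter_not T (· ≤ K)]
  have h1 : ∑ k ∈ T with k ≤ K, (k : ℝ) ^ (a - 1) ≤ (K : ℝ) ^ a / a := by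
    refine le_trans (Finset.sum_le_sum_of_subset_of_nonneg (fun k hk => ?_) fun k _ _ => ?_)
      (sum_Icc_rpow_sub_one_le ha ha1 K)
    · rw [Finset.mem_filter] at hk
      exact Finset.mem_Icc.2 ⟨hT k hk.1, hk.2⟩
    · positivity
  have h2 : ∑ k ∈ T with ¬ k ≤ K, (k : ℝ) ^ (a - 1) ≤ (K : ℝ) ^ a := by
    calc ∑ k ∈ T with ¬ k ≤ K, (k : ℝ) ^ (a - 1)
        ≤ ∑ k ∈ T with ¬ k ≤ K, (K : ℝ) ^ (a - 1) := by
          refine Finset.sum_le_sum fun k hk => ?_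
          rw [Finset.mem_filter, not_le] at hk
          exact Real.rpow_le_rpow_of_nonpos hK0 (by exact_mod_cast hk.2.le) (by linarith)
      _ ≤ K * (K : ℝ) ^ (a - 1) := by
          rw [Finset.sum_const, nsmul_eq_mul]
          gcongr
          exact (Finset.card_filter_le _ _).trans hcard
      _ = (K : ℝ) ^ a := by
          rw [Real.rpow_sub hK0, Real.rpow_one]; field_simp
  have h3 : (K : ℝ) ^ a ≤ (K : ℝ) ^ a / a := le_div_self (by positivity) ha ha1
  calc _ ≤ (K : ℝ) ^ a / a + (K : ℝ) ^ a / a := by linarith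
    _ = _ := by ring

/-- The primes modulo which `q` has order `d` divide `q ^ d - 1`, so there are few of them. -/
lemma card_primes_orderOf_eq_le {q d : ℕ} (hq : 2 ≤ q) (hd : 1 ≤ d) {P : Finset ℕ}
    (hP : ∀ p ∈ P, p.Prime ∧ orderOf (q : ZMod p) = d) : P.card ≤ q * d := by
  have hqd : 1 < q ^ d := Nat.one_lt_pow (by omega) (by omega)
  have hdvd : ∏ p ∈ P, p ∣ q ^ d - 1 := by
    refine Finset.prod_primes_dvd _ (fun p hp => (hP p hp).1.prime) fun p hp => ?_
    rw [← ZMod.natCast_eq_zero_iff, Nat.cast_sub hqd.le]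
    have := pow_orderOf_eq_one (q : ZMod p)
    rw [(hP p hp).2] at this
    simp [this]
  have h1 : 2 ^ P.card ≤ 2 ^ (q * d) :=
    calc 2 ^ P.card ≤ ∏ p ∈ P, p := Finset.pow_card_le_prod _ _ _ fun p hp => (hP p hp).1.two_le
      _ ≤ q ^ d - 1 := Nat.le_of_dvd (by omega) hdvd
      _ ≤ q ^ d := Nat.sub_le _ _
      _ ≤ (2 ^ q) ^ d := Nat.pow_le_pow_left Nat.lt_two_pow_self.le _
      _ = 2 ^ (q * d) := (pow_mul _ _ _).symm
  exact (Nat.pow_le_pow_iff_right (by norm_num)).1 h1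

lemma sum_rpow_primes_orderOf_eq_le {a : ℝ} (ha : 0 < a) (ha1 : a ≤ 1) {q d : ℕ} (hq : 2 ≤ q)
    (hd : 1 ≤ d) {P : Finset ℕ} (hP : ∀ p ∈ P, p.Prime ∧ orderOf (q : ZMod p) = d) :
    ∑ p ∈ P, (p : ℝ) ^ (a - 1) ≤ 2 * q / a * (d : ℝ) ^ (2 * a - 1) := by
  have hd0 : (0 : ℝ) < d := by exact_mod_cast hd
  have hq1 : (1 : ℝ) ≤ q := by exact_mod_cast (by omega : 1 ≤ q)
  have hdvd : ∀ p ∈ P, d ∣ p - 1 := by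
    intro p hp
    have : Fact p.Prime := ⟨(hP p hp).1⟩
    rw [← (hP p hp).2]
    refine ZMod.orderOf_dvd_card_sub_one fun h0 => ?_
    have h2 := (hP p hp).2
    rw [h0, orderOf_zero] at h2
    omega
  have hdiv : ∀ p ∈ P, 1 ≤ (p - 1) / d ∧ d * ((p - 1) / d) = p - 1 := by
    intro p hp
    have h2 := (hP p hp).1.two_le
    exact ⟨Nat.div_pos (Nat.le_of_dvd (by omega) (hdvd p hp)) hd, Nat.mul_div_cancel' (hdvd p hp)⟩
  have hinj : Set.InjOn (fun p => (p - 1) / d) P := by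
    intro p hp p' hp' h
    have h1 := hdiv p hp
    have h2 := hdiv p' hp'
    have h3 := (hP p hp).1.two_le
    have h4 := (hP p' hp').1.two_le
    simp only at h
    rw [h] at h1
    omega
  have hsum := sum_rpow_sub_one_le_of_card_le ha ha1 (T := P.image fun p => (p - 1) / d)
    (K := q * d) (by
      intro k hk
      obtain ⟨p, hp, rfl⟩ := Finset.mem_image.1 hk
      exact (hdiv p hp).1) (Nat.mul_pos (by omega) hd)
    (Finset.card_image_le.trans (card_primes_orderOf_eq_le hq hd hP))
  rw [Finset.sum_image hinj] at hsum
  calc ∑ p ∈ P, (p : ℝ) ^ (a - 1)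
      ≤ ∑ p ∈ P, (d : ℝ) ^ (a - 1) * (((p - 1) / d : ℕ) : ℝ) ^ (a - 1) := by
        refine Finset.sum_le_sum fun p hp => ?_
        obtain ⟨h1, h2⟩ := hdiv p hp
        have h3 : (0 : ℝ) < ((p - 1) / d : ℕ) := by exact_mod_cast h1
        rw [← Real.mul_rpow hd0.le h3.le]
        refine Real.rpow_le_rpow_of_nonpos (by positivity) ?_ (by linarith)
        exact_mod_cast h2.le.trans (Nat.sub_le _ _)
    _ ≤ (d : ℝ) ^ (a - 1) * (2 / a * ((q * d : ℕ) : ℝ) ^ a) := by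
        rw [← Finset.mul_sum]; gcongr
    _ = 2 / a * (q : ℝ) ^ a * (d : ℝ) ^ (2 * a - 1) := by
        rw [show 2 * a - 1 = (a - 1) + a by ring, Real.rpow_add hd0, Nat.cast_mul,
          Real.mul_rpow (by positivity) hd0.le]
        ring
    _ ≤ 2 / a * q * (d : ℝ) ^ (2 * a - 1) := by
        gcongr
        exact (Real.rpow_le_rpow_of_exponent_le hq1 ha1).trans (Real.rpow_one _).le
    _ = _ := by ring

lemma sum_rpow_primes_orderOf_dvd_le {a : ℝ} (ha : 0 < a) (ha1 : a ≤ 1 / 4) {q m : ℕ} (hq : 2 ≤ q)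
    (hm : m ≠ 0) {P : Finset ℕ} (hP : ∀ p ∈ P, p.Prime ∧ orderOf (q : ZMod p) ∣ m) :
    ∑ p ∈ P, (p : ℝ) ^ (a - 1) ≤
      2 * q / a * Real.exp (4 * ∑ p ∈ m.primeFactors, (p : ℝ) ^ (2 * a - 1)) := by
  rw [← Finset.sum_fiberwise_of_maps_to (t := m.divisors) (g := fun p => orderOf (q : ZMod p))
    fun p hp => Nat.mem_divisors.2 ⟨(hP p hp).2, hm⟩]
  calc _ ≤ ∑ d ∈ m.divisors, 2 * q / a * (d : ℝ) ^ (2 * a - 1) := by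
        refine Finset.sum_le_sum fun d hd => ?_
        refine sum_rpow_primes_orderOf_eq_le ha (by linarith) hq (Nat.pos_of_mem_divisors hd) ?_
        intro p hp
        rw [Finset.mem_filter] at hp
        exact ⟨(hP p hp.1).1, hp.2⟩
    _ ≤ _ := by
        rw [← Finset.mul_sum]
        gcongr
        have := sum_rpow_neg_le_exp (c := 1 - 2 * a) (by linarith) (s := m.primeFactors)
          (T := m.divisors) (fun p hp => Nat.prime_of_mem_primeFactors hp) fun d hd =>
            ⟨(Nat.pos_of_mem_divisors hd).ne',
              Nat.primeFactors_mono (Nat.dvd_of_mem_divisors hd) hm⟩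
        simpa only [neg_sub] using this

/-- Rankin's bound for the number of moduli up to `x` with respect to which `q` has order `m`. -/
lemma card_orderOf_eq_le {a : ℝ} (ha : 0 < a) (ha1 : a ≤ 1 / 4) {q m : ℕ} (hq : 2 ≤ q)
    (hm : m ≠ 0) {x : ℝ} (hx : 0 ≤ x) {T : Finset ℕ}
    (hT : ∀ e ∈ T, e ≠ 0 ∧ (e : ℝ) ≤ x ∧ orderOf (q : ZMod e) = m) :
    (T.card : ℝ) ≤ x ^ (1 - a) * Real.exp (4 * (2 * q / a *
      Real.exp (4 * ∑ p ∈ m.primeFactors, (p : ℝ) ^ (2 * a - 1)))) := by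
  have hs : ∀ p ∈ T.biUnion Nat.primeFactors, p.Prime ∧ orderOf (q : ZMod p) ∣ m := by
    intro p hp
    obtain ⟨e, he, hpe⟩ := Finset.mem_biUnion.1 hp
    refine ⟨Nat.prime_of_mem_primeFactors hpe, ?_⟩
    rw [← (hT e he).2.2]
    have := orderOf_map_dvd (ZMod.castHom (Nat.dvd_of_mem_primeFactors hpe) (ZMod p)).toMonoidHom
      (q : ZMod e)
    simpa using this
  have h1 := sum_rpow_neg_le_exp (c := 1 - a) (by linarith) (s := T.biUnion Nat.primeFactors)
    (T := T) (fun p hp => (hs p hp).1) fun e he =>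
      ⟨(hT e he).1, Finset.subset_biUnion_of_mem Nat.primeFactors he⟩
  have h2 := sum_rpow_primes_orderOf_dvd_le ha ha1 hq hm hs
  rw [neg_sub] at h1
  calc (T.card : ℝ) = ∑ e ∈ T, 1 := by simp
    _ ≤ ∑ e ∈ T, x ^ (1 - a) * (e : ℝ) ^ (a - 1) := by
        refine Finset.sum_le_sum fun e he => ?_
        obtain ⟨he0, hex, -⟩ := hT e he
        have he1 : (0 : ℝ) < e := by exact_mod_cast Nat.pos_of_ne_zero he0
        have h3 : (1 : ℝ) = (e : ℝ) ^ (1 - a) * (e : ℝ) ^ (a - 1) := by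
          rw [← Real.rpow_add he1]; simp
        refine h3.le.trans (mul_le_mul_of_nonneg_right ?_ (by positivity))
        exact Real.rpow_le_rpow he1.le hex (by linarith)
    _ ≤ _ := by
        rw [← Finset.mul_sum]
        gcongr
        exact h1.trans (Real.exp_le_exp.2 (by linarith))

lemma card_primes_log_eq_le {i : ℕ} {B : Finset ℕ} (hB : ∀ p ∈ B, p.Prime ∧ Nat.log 2 p = i) :
    i * B.card ≤ 4 * 2 ^ i := by
  have hlt : ∀ p ∈ B, p < 2 ^ (i + 1) := fun p hp => by
    rw [← (hB p hp).2]; exact Nat.lt_pow_succ_log_self (by norm_num) p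
  have hge : ∀ p ∈ B, 2 ^ i ≤ p := fun p hp => by
    rw [← (hB p hp).2]; exact Nat.pow_log_le_self 2 (hB p hp).1.ne_zero
  have h1 : 2 ^ (i * B.card) ≤ 2 ^ (4 * 2 ^ i) :=
    calc 2 ^ (i * B.card) = (2 ^ i) ^ B.card := pow_mul _ _ _
      _ ≤ ∏ p ∈ B, p := Finset.pow_card_le_prod _ _ _ hge
      _ ≤ primorial (2 ^ (i + 1)) := by
          refine Finset.prod_le_prod_of_subset_of_one_le' (fun p hp => ?_) fun p hp _ => ?_
          · simp only [Finset.mem_filter, Finset.mem_range]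
            exact ⟨(hlt p hp).trans (Nat.lt_succ_self _), (hB p hp).1⟩
          · exact (Finset.mem_filter.1 hp).2.one_le
      _ ≤ 4 ^ (2 ^ (i + 1)) := primorial_le_four_pow _
      _ = 2 ^ (4 * 2 ^ i) := by
          rw [show (4 : ℕ) = 2 ^ 2 by norm_num, ← pow_mul]; congr 1; ring
  exact (Nat.pow_le_pow_iff_right (by norm_num)).1 h1

lemma sum_rpow_primes_log_eq_le {δ : ℝ} (hδ1 : δ ≤ 1) {i : ℕ} (hi : 1 ≤ i) {B : Finset ℕ}
    (hB : ∀ p ∈ B, p.Prime ∧ Nat.log 2 p = i) :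
    ∑ p ∈ B, (p : ℝ) ^ (δ - 1) ≤ 4 * (((2 : ℝ) ^ δ) ^ i / i) := by
  have hi0 : (0 : ℝ) < i := by exact_mod_cast hi
  have hcard : (B.card : ℝ) ≤ 4 * 2 ^ i / i := by
    rw [le_div_iff₀ hi0, mul_comm]
    exact_mod_cast card_primes_log_eq_le hB
  have h2 : (0 : ℝ) < 2 ^ i := by positivity
  calc ∑ p ∈ B, (p : ℝ) ^ (δ - 1) ≤ ∑ p ∈ B, ((2 : ℝ) ^ i) ^ (δ - 1) := by
        refine Finset.sum_le_sum fun p hp => Real.rpow_le_rpow_of_nonpos h2 ?_ (by linarith)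
        have : 2 ^ i ≤ p := by
          rw [← (hB p hp).2]; exact Nat.pow_log_le_self 2 (hB p hp).1.ne_zero
        exact_mod_cast this
    _ ≤ 4 * 2 ^ i / i * ((2 : ℝ) ^ i) ^ (δ - 1) := by
        rw [Finset.sum_const, nsmul_eq_mul]; gcongr
    _ = 4 * (((2 : ℝ) ^ δ) ^ i / i) := by
        rw [Real.rpow_sub h2, Real.rpow_one, ← Real.rpow_natCast, ← Real.rpow_natCast,
          ← Real.rpow_mul (by norm_num), ← Real.rpow_mul (by norm_num), mul_comm (i : ℝ) δ]
        field_simp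

lemma two_rpow_pow_le {δ t : ℝ} (hδ : 0 ≤ δ) {i : ℕ} (hi : (2 : ℝ) ^ i ≤ Real.exp t) :
    ((2 : ℝ) ^ δ) ^ i ≤ Real.exp (δ * t) := by
  calc ((2 : ℝ) ^ δ) ^ i = ((2 : ℝ) ^ i) ^ δ := by
        rw [← Real.rpow_natCast, ← Real.rpow_natCast, ← Real.rpow_mul (by norm_num),
          ← Real.rpow_mul (by norm_num), mul_comm]
    _ ≤ (Real.exp t) ^ δ := by gcongr
    _ = Real.exp (δ * t) := by rw [← Real.exp_mul, mul_comm]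

lemma sum_Icc_two_rpow_pow_div_le {δ L : ℝ} (hδ : 0 < δ) (hδ1 : δ ≤ 1) (hL : 1 ≤ L) {I : ℕ}
    (hI : (2 : ℝ) ^ I ≤ Real.exp L) :
    ∑ i ∈ Finset.Icc 1 I, ((2 : ℝ) ^ δ) ^ i / i ≤
      Real.exp (δ * (L / 2)) * (1 + Real.log (2 * L)) + 8 * Real.exp (δ * L) / (L * δ) := by
  have hL0 : 0 < L := by linarith
  have hl2 : 1 / 2 < Real.log 2 := by linarith [Real.log_two_gt_d9]
  have hl2' : Real.log 2 < 1 := by linarith [Real.log_two_lt_d9]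
  set r : ℝ := (2 : ℝ) ^ δ with hr
  have hr1 : 1 + δ / 2 ≤ r := by
    have : r = Real.exp (Real.log 2 * δ) := by rw [hr, Real.rpow_def_of_pos (by norm_num)]
    rw [this]
    nlinarith [Real.add_one_le_exp (Real.log 2 * δ)]
  have hr2 : r ≤ 2 := by
    calc r ≤ (2 : ℝ) ^ (1 : ℝ) := Real.rpow_le_rpow_of_exponent_le (by norm_num) hδ1
      _ = 2 := Real.rpow_one _
  have hr0 : 0 < r := by linarith
  have hIL : (I : ℝ) ≤ 2 * L := by
    have := Real.log_le_log (by positivity) hI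
    rw [Real.log_exp, Real.log_pow] at this
    nlinarith [(Nat.cast_nonneg I : (0 : ℝ) ≤ I)]
  rw [← Finset.sum_filter_add_sum_filter_not (Finset.Icc 1 I) (fun i => (i : ℝ) ≤ L / 2)]
  refine add_le_add ?_ ?_
  · set A := (Finset.Icc 1 I).filter (fun i : ℕ => (i : ℝ) ≤ L / 2) with hA
    calc ∑ i ∈ A, r ^ i / i
        ≤ ∑ i ∈ A, Real.exp (δ * (L / 2)) * (i : ℝ)⁻¹ := by
          refine Finset.sum_le_sum fun i hi => ?_
          rw [div_eq_mul_inv]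
          gcongr
          refine two_rpow_pow_le hδ.le ?_
          rw [hA, Finset.mem_filter] at hi
          calc (2 : ℝ) ^ i = Real.exp (Real.log 2 * i) := by
                rw [mul_comm, Real.exp_nat_mul, Real.exp_log (by norm_num)]
            _ ≤ Real.exp (L / 2) := by
                refine Real.exp_le_exp.2 ?_
                nlinarith [(Nat.cast_nonneg i : (0 : ℝ) ≤ i)]
      _ ≤ ∑ i ∈ Finset.Icc 1 I, Real.exp (δ * (L / 2)) * (i : ℝ)⁻¹ :=
          Finset.sum_le_sum_of_subset_of_nonneg (Finset.filter_subset _ _)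
            fun i _ _ => by positivity
      _ ≤ Real.exp (δ * (L / 2)) * (1 + Real.log (2 * L)) := by
          rw [← Finset.mul_sum]
          gcongr
          have h1 := harmonic_le_one_add_log I
          rw [harmonic_eq_sum_Icc] at h1
          push_cast at h1
          refine h1.trans ?_
          rcases Nat.eq_zero_or_pos I with rfl | hI0
          · simp only [CharP.cast_eq_zero, Real.log_zero, add_zero, le_add_iff_nonneg_right]
            exact Real.log_nonneg (by linarith)
          · have : (0 : ℝ) < I := by exact_mod_cast hI0
            gcongr
  · set A := (Finset.Icc 1 I).filter (fun i : ℕ => ¬ (i : ℝ) ≤ L / 2) with hA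
    calc ∑ i ∈ A, r ^ i / i
        ≤ ∑ i ∈ A, 2 / L * r ^ i := by
          refine Finset.sum_le_sum fun i hi => ?_
          rw [hA, Finset.mem_filter, not_le] at hi
          have hi0 : (0 : ℝ) < i := by linarith [hi.2]
          rw [div_mul_eq_mul_div, div_le_div_iff₀ hi0 hL0]
          nlinarith [pow_pos hr0 i]
      _ ≤ ∑ i ∈ Finset.range (I + 1), 2 / L * r ^ i := by
          refine Finset.sum_le_sum_of_subset_of_nonneg (fun i hi => ?_) fun i _ _ => by positivity
          simp only [hA, Finset.mem_filter, Finset.mem_Icc] at hi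
          exact Finset.mem_range.2 (by omega)
      _ ≤ 2 / L * (4 * Real.exp (δ * L) / δ) := by
          rw [← Finset.mul_sum]
          gcongr
          rw [geom_sum_eq (by linarith), div_le_div_iff₀ (by linarith) hδ, pow_succ]
          have h3 : r ^ I ≤ Real.exp (δ * L) := two_rpow_pow_le hδ.le hI
          have h4 : 0 < r ^ I := pow_pos hr0 I
          have h5 := Real.exp_pos (δ * L)
          calc (r ^ I * r - 1) * δ ≤ (Real.exp (δ * L) * 2) * δ := by
                gcongr
                nlinarith
            _ ≤ 4 * Real.exp (δ * L) * (r - 1) := by nlinarith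
      _ = _ := by field_simp; ring

/-- Chebyshev-type bound for the sum of `p ^ (δ - 1)` over the prime factors of `m`. -/
lemma sum_primeFactors_rpow_le {δ L : ℝ} (hδ : 0 < δ) (hδ1 : δ ≤ 1) (hL : 1 ≤ L) {m : ℕ}
    (hm : m ≠ 0) (hmL : (m : ℝ) ≤ Real.exp (Real.exp L)) :
    ∑ p ∈ m.primeFactors, (p : ℝ) ^ (δ - 1) ≤
      4 * (Real.exp (δ * (L / 2)) * (1 + Real.log (2 * L)) + 8 * Real.exp (δ * L) / (L * δ)) +
      Real.exp (δ * L) / L := by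
  have hL0 : 0 < L := by linarith
  rw [← Finset.sum_filter_add_sum_filter_not m.primeFactors (fun p => (p : ℝ) ≤ Real.exp L)]
  refine add_le_add ?_ ?_
  · set I := Nat.log 2 ⌊Real.exp L⌋₊ with hIdef
    have hfl : ⌊Real.exp L⌋₊ ≠ 0 := by
      rw [← Nat.pos_iff_ne_zero, Nat.floor_pos]
      exact Real.one_le_exp hL0.le
    have hI : (2 : ℝ) ^ I ≤ Real.exp L := by
      have h1 : 2 ^ I ≤ ⌊Real.exp L⌋₊ := Nat.pow_log_le_self 2 hfl
      calc (2 : ℝ) ^ I ≤ ⌊Real.exp L⌋₊ := by exact_mod_cast h1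
        _ ≤ _ := Nat.floor_le (Real.exp_pos L).le
    rw [← Finset.sum_fiberwise_of_maps_to (t := Finset.Icc 1 I) (g := Nat.log 2)]
    · refine le_trans (Finset.sum_le_sum fun i hi => ?_) ((Finset.mul_sum _ _ _).symm.le.trans
        (mul_le_mul_of_nonneg_left (sum_Icc_two_rpow_pow_div_le hδ hδ1 hL hI) (by norm_num)))
      refine sum_rpow_primes_log_eq_le hδ1 (Finset.mem_Icc.1 hi).1 fun p hp => ?_
      simp only [Finset.mem_filter] at hp
      exact ⟨Nat.prime_of_mem_primeFactors hp.1.1, hp.2⟩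
    · intro p hp
      rw [Finset.mem_filter] at hp
      have h2 := (Nat.prime_of_mem_primeFactors hp.1).two_le
      exact Finset.mem_Icc.2 ⟨Nat.log_pos (by norm_num) h2, Nat.log_mono_right (Nat.le_floor hp.2)⟩
  · set B := m.primeFactors.filter (fun p : ℕ => ¬ (p : ℝ) ≤ Real.exp L) with hB
    have hBp : ∀ p ∈ B, Real.exp L ≤ p := fun p hp => (not_le.1 (Finset.mem_filter.1 hp).2).le
    have hprod : (Real.exp L) ^ B.card ≤ Real.exp (Real.exp L) :=
      calc (Real.exp L) ^ B.card = ∏ p ∈ B, Real.exp L := by simp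
        _ ≤ ∏ p ∈ B, (p : ℝ) := Finset.prod_le_prod (fun _ _ => (Real.exp_pos L).le) hBp
        _ = ((∏ p ∈ B, p : ℕ) : ℝ) := by push_cast; rfl
        _ ≤ m := by
            have h1 : ∏ p ∈ B, p ∣ m :=
              (Finset.prod_dvd_prod_of_subset _ _ _ (Finset.filter_subset _ _)).trans
                (Nat.prod_primeFactors_dvd m)
            exact_mod_cast Nat.le_of_dvd (Nat.pos_of_ne_zero hm) h1
        _ ≤ _ := hmL
    have hcard : (B.card : ℝ) ≤ Real.exp L / L := by
      rw [← Real.exp_nat_mul, Real.exp_le_exp] at hprod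
      rwa [le_div_iff₀ hL0]
    calc ∑ p ∈ B, (p : ℝ) ^ (δ - 1) ≤ ∑ p ∈ B, (Real.exp L) ^ (δ - 1) :=
          Finset.sum_le_sum fun p hp =>
            Real.rpow_le_rpow_of_nonpos (Real.exp_pos L) (hBp p hp) (by linarith)
      _ ≤ Real.exp L / L * (Real.exp L) ^ (δ - 1) := by
          rw [Finset.sum_const, nsmul_eq_mul]; gcongr
      _ = Real.exp (δ * L) / L := by
          rw [← Real.exp_mul, div_mul_eq_mul_div, ← Real.exp_add]; congr 2; ring

open Filter in
lemma eventually_prime_sum_bound_le :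
    ∀ᶠ L : ℝ in atTop,
      4 * (Real.exp ((3 + Real.log L) / L * (L / 2)) * (1 + Real.log (2 * L)) +
        8 * Real.exp ((3 + Real.log L) / L * L) / (L * ((3 + Real.log L) / L))) +
        Real.exp ((3 + Real.log L) / L * L) / L ≤ L / 8 := by
  have h1 : ∀ᶠ L : ℝ in atTop, 4 * Real.exp (3 / 2) * (1 + Real.log (2 * L)) ≤ √L / 24 := by
    have ho : (fun L : ℝ => 4 * Real.exp (3 / 2) * (1 + Real.log 2 + Real.log L))
        =o[atTop] fun L : ℝ => L ^ (1 / 2 : ℝ) := by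
      refine Asymptotics.IsLittleO.const_mul_left (Asymptotics.IsLittleO.add ?_ ?_) _
      · exact Asymptotics.isLittleO_const_left.2
          (Or.inr (tendsto_norm_atTop_atTop.comp (tendsto_rpow_atTop (by norm_num))))
      · exact isLittleO_log_rpow_atTop (by norm_num)
    filter_upwards [ho.bound (show (0 : ℝ) < 1 / 24 by norm_num), eventually_gt_atTop 0]
      with L hL hL0
    rw [Real.log_mul (by norm_num) hL0.ne', Real.sqrt_eq_rpow, ← add_assoc]
    rw [Real.norm_eq_abs, Real.norm_of_nonneg (by positivity)] at hL
    linarith [le_abs_self (4 * Real.exp (3 / 2) * (1 + Real.log 2 + Real.log L))]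
  filter_upwards [h1, Real.tendsto_log_atTop.eventually_ge_atTop (32 * 24 * Real.exp 3),
    eventually_ge_atTop (24 * Real.exp 3), eventually_gt_atTop 0] with L h1 h2 h3 hL0
  have he := Real.exp_pos 3
  have hl : 0 < 3 + Real.log L := by linarith
  have e1 : (3 + Real.log L) / L * L = 3 + Real.log L := by field_simp
  have e2 : (3 + Real.log L) / L * (L / 2) = 3 / 2 + Real.log L / 2 := by field_simp
  have e3 : L * ((3 + Real.log L) / L) = 3 + Real.log L := by field_simp
  rw [e1, e2, e3, Real.exp_add, Real.exp_add, Real.exp_log hL0]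
  have e4 : Real.exp (Real.log L / 2) = √L := by
    rw [Real.exp_half, Real.exp_log hL0]
  rw [e4]
  have h4 : 8 * (Real.exp 3 * L) / (3 + Real.log L) ≤ L / (4 * 24) := by
    rw [div_le_div_iff₀ hl (by norm_num)]
    nlinarith
  have h5 : Real.exp 3 * L / L = Real.exp 3 := by field_simp
  have h6 := mul_le_mul_of_nonneg_left h1 (Real.sqrt_nonneg L)
  have h7 := Real.mul_self_sqrt hL0.le
  rw [h5]
  nlinarith

open Filter in
lemma eventually_rankin_exponent_le (q : ℕ) :
    ∀ᶠ L : ℝ in atTop,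
      4 * (2 * q / ((3 + Real.log L) / L / 2) * Real.exp (L / 2)) ≤ Real.exp L / (4 * L) := by
  have h1 : ∀ᶠ L : ℝ in atTop, 64 * q * L ^ 2 ≤ Real.exp (L / 2) := by
    have ho := (isLittleO_pow_exp_pos_mul_atTop (k := 2) (b := 1 / 2) (by norm_num)).const_mul_left
      (64 * (q : ℝ))
    filter_upwards [ho.bound one_pos] with L hL
    rw [one_mul, Real.norm_eq_abs, Real.norm_of_nonneg (Real.exp_pos _).le] at hL
    rw [show L / 2 = 1 / 2 * L by ring]
    exact (le_abs_self _).trans hL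
  filter_upwards [h1, eventually_ge_atTop 1] with L h1 hL
  have hL0 : 0 < L := by linarith
  have hl := Real.log_nonneg hL
  have h2 : 2 * q / ((3 + Real.log L) / L / 2) ≤ 4 * q * L := by
    rw [div_le_iff₀ (by positivity)]
    have : 4 * q * L * ((3 + Real.log L) / L / 2) = 2 * q * (3 + Real.log L) := by
      field_simp; ring
    rw [this]
    nlinarith [(Nat.cast_nonneg q : (0 : ℝ) ≤ q), mul_nonneg (Nat.cast_nonneg q : (0 : ℝ) ≤ q) hl]
  have h3 : Real.exp L = Real.exp (L / 2) * Real.exp (L / 2) := by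
    rw [← Real.exp_add]; congr 1; ring
  have h4 := Real.exp_pos (L / 2)
  rw [le_div_iff₀ (by linarith), h3]
  calc 4 * (2 * q / ((3 + Real.log L) / L / 2) * Real.exp (L / 2)) * (4 * L)
      ≤ 4 * (4 * q * L * Real.exp (L / 2)) * (4 * L) := by gcongr
    _ = 64 * q * L ^ 2 * Real.exp (L / 2) := by ring
    _ ≤ _ := by gcongr

open Filter in
lemma eventually_one_add_exp_le :
    ∀ᶠ L : ℝ in atTop, 1 + Real.exp L ≤ Real.exp (Real.exp L / (4 * L)) := by
  have ho := (isLittleO_pow_exp_pos_mul_atTop (k := 2) (b := 1) (by norm_num)).const_mul_left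
      (8 : ℝ)
  filter_upwards [ho.bound one_pos, eventually_ge_atTop 1] with L h hL
  rw [one_mul, one_mul, Real.norm_eq_abs, Real.norm_of_nonneg (Real.exp_pos _).le] at h
  have h' := (le_abs_self _).trans h
  have h2 : L + 1 ≤ Real.exp L / (4 * L) := by
    rw [le_div_iff₀ (by linarith)]
    nlinarith
  calc 1 + Real.exp L ≤ Real.exp L * Real.exp 1 := by
        nlinarith [Real.add_one_le_exp 1, Real.one_le_exp (by linarith : 0 ≤ L)]
    _ = Real.exp (L + 1) := (Real.exp_add _ _).symm
    _ ≤ _ := Real.exp_le_exp.2 h2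

open Filter in
lemma eventually_rankin_shift_le : ∀ᶠ L : ℝ in atTop, (3 + Real.log L) / L ≤ 1 / 2 := by
  filter_upwards [Real.isLittleO_log_id_atTop.bound (show (0 : ℝ) < 1 / 4 by norm_num),
    eventually_ge_atTop 12] with L h hL
  rw [id, Real.norm_eq_abs, Real.norm_of_nonneg (by linarith)] at h
  rw [div_le_iff₀ (by linarith)]
  linarith [le_abs_self (Real.log L)]

/-- Grouping the moduli by the order of `q` reduces the double sum to counting moduli with
a given order. -/
lemma sum_sum_totient_div_orderOf_le {q : ℕ} {x B : ℝ} (hx : 1 ≤ x) {D : Finset ℕ}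
    (hD : ∀ d ∈ D, 1 ≤ d ∧ (d : ℝ) ≤ x ∧ q.Coprime d)
    (hB : ∀ m : ℕ, m ≠ 0 → (m : ℝ) ≤ x → ∀ T : Finset ℕ,
      (∀ e ∈ T, e ≠ 0 ∧ (e : ℝ) ≤ x ∧ orderOf (q : ZMod e) = m) → (T.card : ℝ) ≤ B) :
    ∑ d ∈ D, ∑ e ∈ d.divisors, (Nat.totient e : ℝ) / orderOf (q : ZMod e) ≤
      x * ((1 + Real.log x) * B) := by
  set N := ⌊x⌋₊ with hN
  have hx0 : 0 ≤ x := by linarith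
  have hB0 : 0 ≤ B := by simpa using hB 1 one_ne_zero (by simpa using hx) ∅ (by simp)
  set E := (Finset.Icc 1 N).filter fun e => q.Coprime e with hE
  have hE' : ∀ e ∈ E, 1 ≤ e ∧ (e : ℝ) ≤ x ∧ q.Coprime e := fun e he => by
    rw [hE, Finset.mem_filter, Finset.mem_Icc] at he
    exact ⟨he.1.1, (Nat.le_floor_iff hx0).1 he.1.2, he.2⟩
  have hord : ∀ e ∈ E, orderOf (q : ZMod e) ∈ Finset.Icc 1 N := by
    intro e he
    obtain ⟨h1, h2, h3⟩ := hE' e he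
    have hdvd : orderOf (q : ZMod e) ∣ e.totient := by
      rw [orderOf_dvd_iff_pow_eq_one]
      exact_mod_cast (ZMod.natCast_eq_natCast_iff _ _ _).2 (Nat.ModEq.pow_totient h3)
    have hpos : 0 < e.totient := Nat.totient_pos.2 h1
    refine Finset.mem_Icc.2 ⟨Nat.pos_of_dvd_of_pos hdvd hpos, ?_⟩
    exact (Nat.le_of_dvd hpos hdvd).trans ((Nat.totient_le e).trans (Nat.le_floor h2))
  have hmul : ∀ e ∈ E, ((D.filter (e ∣ ·)).card : ℝ) ≤ x / e := by
    intro e he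
    obtain ⟨h1, h2, h3⟩ := hE' e he
    have h4 : (D.filter (e ∣ ·)).card ≤ N / e := by
      rw [← Nat.Ioc_filter_dvd_card_eq_div]
      refine Finset.card_le_card fun d hd => ?_
      rw [Finset.mem_filter] at hd
      obtain ⟨h5, h6, -⟩ := hD d hd.1
      exact Finset.mem_filter.2 ⟨Finset.mem_Ioc.2 ⟨h5, Nat.le_floor h6⟩, hd.2⟩
    calc ((D.filter (e ∣ ·)).card : ℝ) ≤ ((N / e : ℕ) : ℝ) := by exact_mod_cast h4
      _ ≤ (N : ℝ) / e := Nat.cast_div_le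
      _ ≤ x / e := by gcongr; exact Nat.floor_le hx0
  calc ∑ d ∈ D, ∑ e ∈ d.divisors, (Nat.totient e : ℝ) / orderOf (q : ZMod e)
      = ∑ e ∈ E, ∑ d ∈ D.filter (e ∣ ·), (Nat.totient e : ℝ) / orderOf (q : ZMod e) := by
        refine Finset.sum_comm' fun d e => ?_
        simp only [Nat.mem_divisors, Finset.mem_filter]
        constructor
        · rintro ⟨h1, h2, h3⟩
          obtain ⟨h4, h5, h6⟩ := hD d h1
          refine ⟨⟨h1, h2⟩, Finset.mem_filter.2 ⟨Finset.mem_Icc.2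
            ⟨Nat.pos_of_dvd_of_pos h2 h4, (Nat.le_of_dvd h4 h2).trans (Nat.le_floor h5)⟩,
            h6.coprime_dvd_right h2⟩⟩
        · rintro ⟨⟨h1, h2⟩, -⟩
          exact ⟨h1, h2, Nat.one_le_iff_ne_zero.1 (hD d h1).1⟩
    _ ≤ ∑ e ∈ E, x * (1 / (orderOf (q : ZMod e) : ℝ)) := by
        refine Finset.sum_le_sum fun e he => ?_
        have h1 : (0 : ℝ) < e := by exact_mod_cast (hE' e he).1
        rw [Finset.sum_const, nsmul_eq_mul]
        calc _ ≤ x / e * ((e : ℝ) / orderOf (q : ZMod e)) := by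
              gcongr
              · exact hmul e he
              · exact Nat.totient_le e
          _ = _ := by field_simp
    _ = x * ∑ m ∈ Finset.Icc 1 N, ∑ e ∈ E with orderOf (q : ZMod e) = m, 1 / (m : ℝ) := by
        rw [← Finset.mul_sum, ← Finset.sum_fiberwise_of_maps_to hord]
        congr 1
        refine Finset.sum_congr rfl fun m _ => Finset.sum_congr rfl fun e he => ?_
        rw [(Finset.mem_filter.1 he).2]
    _ ≤ x * ∑ m ∈ Finset.Icc 1 N, (m : ℝ)⁻¹ * B := by
        gcongr with m hm
        rw [Finset.sum_const, nsmul_eq_mul, mul_comm, one_div]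
        rw [Finset.mem_Icc] at hm
        gcongr
        refine hB m (by omega) ((Nat.le_floor_iff hx0).1 hm.2) _ fun e he => ?_
        rw [Finset.mem_filter] at he
        obtain ⟨h1, h2, -⟩ := hE' e he.1
        exact ⟨by omega, h2, he.2⟩
    _ ≤ x * ((1 + Real.log x) * B) := by
        rw [← Finset.sum_mul]
        gcongr
        have h1 := harmonic_floor_le_one_add_log x hx
        rw [harmonic_eq_sum_Icc] at h1
        push_cast at h1
        exact h1

/-- Let `p` be prime and `q` a power of `p`.  There is `x₀(q)`
such that for all `x ≥ x₀(q)`,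
`Σ_{d ≤ x, d ∈ U_p} Σ_{e ∣ d} φ(e)/ℓ_q(e) ≤ x^{2 − (2 + log₃ x)/(2 log₂ x)}`,
where `U_p` is the set of positive integers dividing `p^n + 1` for some `n ≥ 1`
and `ℓ_q(e)` is the multiplicative order of `q` mod `e`. -/
theorem rank_stats_stmt13 (p : ℕ) (hp : p.Prime) (q : ℕ)
    (hq : ∃ k : ℕ, 1 ≤ k ∧ q = p ^ k) :
    ∃ x0 : ℝ, ∀ x : ℝ, x0 ≤ x →
      ∑ d ∈ (Finset.Icc 1 ⌊x⌋₊).filter (fun d => ∃ n : ℕ, 1 ≤ n ∧ d ∣ p ^ n + 1),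
        ∑ e ∈ d.divisors, (Nat.totient e : ℝ) / orderOf ((q : ZMod e))
      ≤ x ^ (2 - (2 + logI 3 x) / (2 * logI 2 x)) := by
  obtain ⟨k, hk, rfl⟩ := hq
  have hq2 : 2 ≤ p ^ k := hp.two_le.trans (Nat.le_self_pow (by omega) p)
  have hlog := Real.tendsto_log_atTop
  have hev : ∀ᶠ x : ℝ in Filter.atTop,
      ∑ d ∈ (Finset.Icc 1 ⌊x⌋₊).filter (fun d => ∃ n : ℕ, 1 ≤ n ∧ d ∣ p ^ n + 1),
        ∑ e ∈ d.divisors, (Nat.totient e : ℝ) / orderOf (((p ^ k : ℕ) : ZMod e))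
      ≤ x ^ (2 - (2 + logI 3 x) / (2 * logI 2 x)) := by
    filter_upwards [(hlog.comp hlog).eventually eventually_prime_sum_bound_le,
      (hlog.comp hlog).eventually (eventually_rankin_exponent_le (p ^ k)),
      (hlog.comp hlog).eventually eventually_one_add_exp_le,
      (hlog.comp hlog).eventually eventually_rankin_shift_le,
      (hlog.comp (hlog.comp hlog)).eventually_ge_atTop 1, (hlog.comp hlog).eventually_ge_atTop 1,
      hlog.eventually_ge_atTop 1, Filter.eventually_ge_atTop 1] with x h1 h2 h3 h4 h5 h6 h7 hx
    simp only [Function.comp_apply] at h1 h2 h3 h4 h5 h6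
    have hI2 : logI 2 x = Real.log (Real.log x) := by
      simp only [logI, max_eq_left h7, max_eq_left h6]
    have hI3 : logI 3 x = Real.log (Real.log (Real.log x)) := by
      simp only [logI, max_eq_left h7, max_eq_left h6, max_eq_left h5]
    rw [hI2, hI3]
    have hx0 : 0 < x := by linarith
    have hexpL : Real.exp (Real.log (Real.log x)) = Real.log x := Real.exp_log (by linarith)
    have hexpx : Real.exp (Real.log x) = x := Real.exp_log hx0
    set L := Real.log (Real.log x) with hL
    have hL0 : 0 < L := by linarith
    set δ := (3 + Real.log L) / L with hδ
    have hδ0 : 0 < δ := by positivity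
    refine (sum_sum_totient_div_orderOf_le
      (B := x ^ (1 - δ / 2) * Real.exp (Real.exp L / (4 * L))) hx (fun d hd => ?_)
      fun m hm hmx T hT => ?_).trans ?_
    · rw [Finset.mem_filter, Finset.mem_Icc] at hd
      obtain ⟨⟨hd1, hd2⟩, n, hn, hdn⟩ := hd
      refine ⟨hd1, (Nat.le_floor_iff hx0.le).1 hd2, Nat.Coprime.pow_left k ?_⟩
      refine Nat.Coprime.coprime_dvd_right hdn ((hp.coprime_iff_not_dvd).2 fun h => ?_)
      exact hp.one_lt.ne' (Nat.dvd_one.1 ((Nat.dvd_add_right (dvd_pow_self p (by omega))).1 h))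
    · refine (card_orderOf_eq_le (a := δ / 2) (by linarith) (by linarith) hq2 hm hx0.le hT).trans ?_
      gcongr
      refine le_trans ?_ h2
      have hW := sum_primeFactors_rpow_le hδ0 (by linarith) h6 hm
        (by rw [hexpL, hexpx]; exact hmx)
      rw [show 2 * (δ / 2) - 1 = δ - 1 by ring]
      gcongr
      linarith
    · rw [hexpL] at h3
      calc x * ((1 + Real.log x) * (x ^ (1 - δ / 2) * Real.exp (Real.exp L / (4 * L))))
          ≤ x * (Real.exp (Real.log x / (4 * L)) *
              (x ^ (1 - δ / 2) * Real.exp (Real.exp L / (4 * L)))) := by gcongr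
        _ = Real.exp (Real.log x) * (Real.exp (Real.log x / (4 * L)) *
              (Real.exp (Real.log x * (1 - δ / 2)) * Real.exp (Real.log x / (4 * L)))) := by
            rw [hexpL, Real.rpow_def_of_pos hx0, hexpx]
        _ = x ^ (2 - (2 + Real.log L) / (2 * L)) := by
            rw [Real.rpow_def_of_pos hx0, ← Real.exp_add, ← Real.exp_add, ← Real.exp_add, hδ]
            congr 1
            field_simp
            ring
  exact Filter.eventually_atTop.1 hev
end
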